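/- The Gaunt integral formula holds: ∫_{S²} Y_{l₁m₁}(x) Y_{l₂m₂}(x) Y_{l₃m₃}(x) dx = √[(2l₁+1)(2l₂+1)(2l₃+1)/(4π)] · ( l₁ l₂ l₃ ; m₁ m₂ m₃ ) · ( l₁ l₂ l₃ ; 0 0 0 ). -/

import Mathlib

open Polynomial

/-- Factorial extended to the integers: `n!` for `n ≥ 0` and `0` for `n < 0`. -/
noncomputable def rfact (n : ℤ) : ℝ := if 0 ≤ n then (n.toNat).factorial else 0

/-- The Wigner 3j symbol, via the Racah single-sum formula. Terms with a negative
factorial argument vanish (note `x / 0 = 0` in Lean), and the symbol vanishes unless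
`m₁ + m₂ + m₃ = 0`. -/
noncomputable def wigner3j (l₁ l₂ l₃ m₁ m₂ m₃ : ℤ) : ℝ :=
  if m₁ + m₂ + m₃ = 0 then
    (-1 : ℝ) ^ (l₁ - l₂ - m₃) *
    Real.sqrt (rfact (l₁ + l₂ - l₃) * rfact (l₁ - l₂ + l₃) * rfact (-l₁ + l₂ + l₃) /
      rfact (l₁ + l₂ + l₃ + 1)) *
    Real.sqrt (rfact (l₁ + m₁) * rfact (l₁ - m₁) * rfact (l₂ + m₂) * rfact (l₂ - m₂) *
      rfact (l₃ + m₃) * rfact (l₃ - m₃)) *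
    ∑ k ∈ Finset.Icc (0 : ℤ) (l₁ + l₂ + l₃),
      (-1 : ℝ) ^ k /
        (rfact k * rfact (l₁ + l₂ - l₃ - k) * rfact (l₁ - m₁ - k) *
          rfact (l₂ + m₂ - k) * rfact (l₃ - l₂ + m₁ + k) * rfact (l₃ - l₁ - m₂ + k))
  else 0

/-- The `l`-th Legendre polynomial, via the Rodrigues formula. -/
noncomputable def legendreP (l : ℕ) : Polynomial ℝ :=
  C ((2 ^ l * (l.factorial : ℝ))⁻¹) * derivative^[l] ((X ^ 2 - 1) ^ l)

/-- Spherical harmonic `Y_{lm}` for `m ≥ 0`, in spherical coordinates `(θ, φ)`. -/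
noncomputable def sphHarmNN (l m : ℕ) (θ φ : ℝ) : ℂ :=
  (((-1 : ℝ) ^ m *
      Real.sqrt ((2 * l + 1) / (4 * Real.pi) *
        (Nat.factorial (l - m)) / (Nat.factorial (l + m))) *
      (Real.sin θ) ^ m *
      (Polynomial.derivative^[m] (legendreP l)).eval (Real.cos θ) : ℝ) : ℂ) *
    Complex.exp ((m : ℂ) * (φ : ℂ) * Complex.I)

/-- Spherical harmonic `Y_{lm}` in spherical coordinates, with the usual convention
`Y_{l,-m} = (−1)^m conj(Y_{lm})` for negative `m`. -/
noncomputable def sphHarm (l : ℕ) (m : ℤ) (θ φ : ℝ) : ℂ :=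
  if 0 ≤ m then sphHarmNN l m.toNat θ φ
  else (-1 : ℂ) ^ (-m).toNat * starRingEnd ℂ (sphHarmNN l (-m).toNat θ φ)


namespace Gaunt
abbrev B := MvPolynomial (Fin 4) ℝ

noncomputable def Om : B →ₗ[ℝ] B :=
  (MvPolynomial.pderiv 0 : Derivation ℝ B B).toLinearMap ∘ₗ
    (MvPolynomial.pderiv 3 : Derivation ℝ B B).toLinearMap -
  (MvPolynomial.pderiv 1 : Derivation ℝ B B).toLinearMap ∘ₗ
    (MvPolynomial.pderiv 2 : Derivation ℝ B B).toLinearMap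

theorem Om_apply (F : B) : Om F = MvPolynomial.pderiv 0 (MvPolynomial.pderiv 3 F) -
    MvPolynomial.pderiv 1 (MvPolynomial.pderiv 2 F) := rfl

open MvPolynomial in
theorem Om_mono (p q : ℕ) : Om (X 0 ^ p * X 1 ^ q * X 2 ^ q * X 3 ^ p : B) =
    ((p : ℝ) ^ 2) • (X 0 ^ (p-1) * X 1 ^ q * X 2 ^ q * X 3 ^ (p-1) : B)
    - ((q : ℝ) ^ 2) • (X 0 ^ p * X 1 ^ (q-1) * X 2 ^ (q-1) * X 3 ^ p : B) := by
  rw [Om_apply]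
  simp [Derivation.leibniz, Derivation.leibniz_pow, pderiv_X, Pi.single_apply, MvPolynomial.smul_eq_C_mul]
  ring

open MvPolynomial in
theorem Om_pow_mono (L : ℕ) : ∀ p q : ℕ, p + q = L →
    (Om ^ L) (X 0 ^ p * X 1 ^ q * X 2 ^ q * X 3 ^ p : B) =
      MvPolynomial.C ((-1) ^ q * (p.factorial : ℝ) * q.factorial * L.factorial) := by
  induction L with
  | zero => 
    intro p q h
    obtain ⟨rfl, rfl⟩ : p = 0 ∧ q = 0 := by omega
    simp
  | succ L ih =>
    intro p q h
    rw [pow_succ, Module.End.mul_apply, Om_mono, map_sub, map_smul, map_smul]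
    rcases p with _ | p <;> rcases q with _ | q
    · omega
    · obtain rfl : L = q := by omega
      simp only [Nat.add_sub_cancel]
      rw [ih 0 L (by omega)]
      simp [MvPolynomial.smul_eq_C_mul, Nat.factorial_succ, pow_succ]
      ring
    · obtain rfl : L = p := by omega
      simp only [Nat.add_sub_cancel]
      rw [ih L 0 (by omega)]
      simp [MvPolynomial.smul_eq_C_mul, Nat.factorial_succ, pow_succ]
      ring
    · simp only [Nat.add_sub_cancel]
      rw [ih p (q+1) (by omega), ih (p+1) q (by omega)]
      have : (L:ℝ) = p + q + 1 := by
        have : L = p + q + 1 := by omega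
        subst this; push_cast; ring
      simp only [MvPolynomial.smul_eq_C_mul, ← MvPolynomial.C_mul, ← MvPolynomial.C_sub]
      congr 1
      simp only [Nat.factorial_succ, pow_succ]
      push_cast
      rw [this]
      ring

noncomputable def lin (x y : ℝ) : B :=
  MvPolynomial.X 0 + MvPolynomial.C y * MvPolynomial.X 1 + MvPolynomial.C x * MvPolynomial.X 2
    + MvPolynomial.C (x * y) * MvPolynomial.X 3

open MvPolynomial in
theorem pd_lin (i : Fin 4) (x y : ℝ) : pderiv i (lin x y) = MvPolynomial.C (![1, y, x, x*y] i) := by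
  fin_cases i <;> simp [lin, pderiv_X, Pi.single_apply, Derivation.leibniz]

open MvPolynomial in
theorem Om_prod (x₁ x₂ x₃ y₁ y₂ y₃ : ℝ) (n₁ n₂ n₃ : ℕ) :
    Om (lin x₁ y₁ ^ n₁ * lin x₂ y₂ ^ n₂ * lin x₃ y₃ ^ n₃) =
      (n₁ * n₂ * ((x₂ - x₁) * (y₂ - y₁))) •
        (lin x₁ y₁ ^ (n₁-1) * lin x₂ y₂ ^ (n₂-1) * lin x₃ y₃ ^ n₃) +
      (n₁ * n₃ * ((x₃ - x₁) * (y₃ - y₁))) •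
        (lin x₁ y₁ ^ (n₁-1) * lin x₂ y₂ ^ n₂ * lin x₃ y₃ ^ (n₃-1)) +
      (n₂ * n₃ * ((x₃ - x₂) * (y₃ - y₂))) •
        (lin x₁ y₁ ^ n₁ * lin x₂ y₂ ^ (n₂-1) * lin x₃ y₃ ^ (n₃-1)) := by
  rw [Om_apply]
  simp only [Derivation.leibniz, Derivation.leibniz_pow, pd_lin, map_add, map_nsmul, smul_eq_mul,
    MvPolynomial.smul_eq_C_mul, nsmul_eq_mul, map_natCast, Derivation.map_natCast, pderiv_C, MvPolynomial.C_mul, MvPolynomial.C_sub]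
  simp
  ring

open MvPolynomial in
theorem Om_zero (x₁ x₂ x₃ y₁ y₂ y₃ : ℝ) (L : ℕ) : ∀ n₁ n₂ n₃ : ℕ, n₁ + n₂ + n₃ = 2 * L → n₁ + n₂ < n₃ →
    (Om ^ L) (lin x₁ y₁ ^ n₁ * lin x₂ y₂ ^ n₂ * lin x₃ y₃ ^ n₃) = 0 := by
  induction L with
  | zero => intro n₁ n₂ n₃ h h'; omega
  | succ L ih =>
    intro n₁ n₂ n₃ h h'
    rw [pow_succ, Module.End.mul_apply, Om_prod, map_add, map_add, map_smul, map_smul, map_smul]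
    rcases n₁ with _ | n₁ <;> rcases n₂ with _ | n₂
    · simp
    · rw [ih 0 (n₂ + 1 - 1) (n₃-1) (by omega) (by omega)]; simp
    · rw [ih (n₁ + 1 - 1) 0 (n₃-1) (by omega) (by omega)]; simp
    · rw [ih (n₁ + 1 - 1) (n₂+1-1) n₃ (by omega) (by omega), ih (n₁ + 1 - 1) (n₂+1) (n₃-1) (by omega) (by omega),
       ih (n₁ + 1) (n₂+1-1) (n₃-1) (by omega) (by omega)]; simp

theorem Om_zero' (x₁ x₂ x₃ y₁ y₂ y₃ : ℝ) (L n₁ n₂ n₃ : ℕ) (h : n₁ + n₂ + n₃ = 2 * L)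
    (h' : n₁ + n₂ < n₃ ∨ n₁ + n₃ < n₂ ∨ n₂ + n₃ < n₁) :
    (Om ^ L) (lin x₁ y₁ ^ n₁ * lin x₂ y₂ ^ n₂ * lin x₃ y₃ ^ n₃) = 0 := by
  rcases h' with h' | h' | h'
  · exact Om_zero _ _ _ _ _ _ L _ _ _ h h'
  · rw [mul_right_comm]; exact Om_zero _ _ _ _ _ _ L _ _ _ (by omega) h'
  · rw [mul_assoc, mul_comm]; exact Om_zero _ _ _ _ _ _ L _ _ _ (by omega) h'

open MvPolynomial in
theorem Om_main (x₁ x₂ x₃ y₁ y₂ y₃ : ℝ) (L : ℕ) : ∀ a b c : ℕ, a + b + c = L →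
    (Om ^ L) (lin x₁ y₁ ^ (a + b) * lin x₂ y₂ ^ (a + c) * lin x₃ y₃ ^ (b + c)) =
      MvPolynomial.C ((L.factorial : ℝ) * (a+b).factorial * (a+c).factorial * (b+c).factorial /
        (a.factorial * b.factorial * c.factorial) *
        (((x₂ - x₁) * (y₂ - y₁)) ^ a * ((x₃ - x₁) * (y₃ - y₁)) ^ b *
          ((x₃ - x₂) * (y₃ - y₂)) ^ c)) := by
  induction L with
  | zero =>
    intro a b c h
    obtain ⟨rfl, rfl, rfl⟩ : a = 0 ∧ b = 0 ∧ c = 0 := by omega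
    simp
  | succ L ih =>
    intro a b c h
    rw [pow_succ, Module.End.mul_apply, Om_prod, map_add, map_add, map_smul, map_smul, map_smul]
    generalize hw₁ : (x₂ - x₁) * (y₂ - y₁) = w₁ at *
    generalize hw₂ : (x₃ - x₁) * (y₃ - y₁) = w₂ at *
    generalize hw₃ : (x₃ - x₂) * (y₃ - y₂) = w₃ at *
    set N : ℝ := (L.factorial : ℝ) * (a+b).factorial * (a+c).factorial * (b+c).factorial /
        (a.factorial * b.factorial * c.factorial) * (w₁ ^ a * w₂ ^ b * w₃ ^ c) with hN
    have key : ∀ n : ℕ, n ≠ 0 → (n.factorial : ℝ) = n * (n-1).factorial := by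
      intro n hn
      rw [← Nat.mul_factorial_pred hn]; push_cast; rfl
    have t₁ : ((((a + b : ℕ) : ℝ)) * ((a + c : ℕ) : ℝ) * w₁) • (Om ^ L)
        (lin x₁ y₁ ^ (a + b - 1) * lin x₂ y₂ ^ (a + c - 1) * lin x₃ y₃ ^ (b + c)) = MvPolynomial.C (a * N) := by
      rcases a with _ | a
      · by_cases hb : b = 0
        · subst hb; simp
        by_cases hc : c = 0
        · subst hc; simp
        rw [Om_zero' _ _ _ _ _ _ _ _ _ _ (by omega) (by omega)]; simp
      · have := ih a b c (by omega)
        rw [show a + 1 + b - 1 = a + b by omega, show a + 1 + c - 1 = a + c by omega, this,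
          MvPolynomial.smul_eq_C_mul, ← MvPolynomial.C_mul, hN, key (a + 1 + b) (by omega), key (a + 1 + c) (by omega),
          key (a+1) (by omega), show a + 1 + b - 1 = a + b by omega, show a + 1 + c - 1 = a + c by omega]
        congr 1
        simp only [Nat.add_sub_cancel, pow_succ]
        field_simp
    have t₂ : ((((a + b : ℕ) : ℝ)) * ((b + c : ℕ) : ℝ) * w₂) • (Om ^ L)
        (lin x₁ y₁ ^ (a + b - 1) * lin x₂ y₂ ^ (a + c) * lin x₃ y₃ ^ (b + c - 1)) = MvPolynomial.C (b * N) := by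
      rcases b with _ | b
      · by_cases hb : a = 0
        · subst hb; simp
        by_cases hc : c = 0
        · subst hc; simp
        rw [Om_zero' _ _ _ _ _ _ _ _ _ _ (by omega) (by omega)]; simp
      · have := ih a b c (by omega)
        rw [show a + (b + 1) - 1 = a + b by omega, show b + 1 + c - 1 = b + c by omega, this,
          MvPolynomial.smul_eq_C_mul, ← MvPolynomial.C_mul, hN, key (a + (b+1)) (by omega), key (b + 1 + c) (by omega),
          key (b+1) (by omega), show a + (b+1) - 1 = a + b by omega, show b + 1 + c - 1 = b + c by omega]
        congr 1
        simp only [Nat.add_sub_cancel, pow_succ]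
        field_simp
    have t₃ : ((((a + c : ℕ) : ℝ)) * ((b + c : ℕ) : ℝ) * w₃) • (Om ^ L)
        (lin x₁ y₁ ^ (a + b) * lin x₂ y₂ ^ (a + c - 1) * lin x₃ y₃ ^ (b + c - 1)) = MvPolynomial.C (c * N) := by
      rcases c with _ | c
      · by_cases hb : a = 0
        · subst hb; simp
        by_cases hc : b = 0
        · subst hc; simp
        rw [Om_zero' _ _ _ _ _ _ _ _ _ _ (by omega) (by omega)]; simp
      · have := ih a b c (by omega)
        rw [show a + (c + 1) - 1 = a + c by omega, show b + (c + 1) - 1 = b + c by omega, this,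
          MvPolynomial.smul_eq_C_mul, ← MvPolynomial.C_mul, hN, key (a + (c+1)) (by omega), key (b + (c+1)) (by omega),
          key (c+1) (by omega), show a + (c+1) - 1 = a + c by omega, show b + (c+1) - 1 = b + c by omega]
        congr 1
        simp only [Nat.add_sub_cancel, pow_succ]
        field_simp
    rw [t₁, t₂, t₃, ← MvPolynomial.C_add, ← MvPolynomial.C_add]
    congr 1
    have hL : ((L + 1 : ℕ) : ℝ) = a + b + c := by rw [← h]; push_cast; ring
    rw [Nat.factorial_succ, Nat.cast_mul, hL, hN]
    ring
end Gaunt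

namespace Gaunt
theorem extract_aux {ι κ : Type*} (S : Finset ι) (T : Finset κ) (c : ι → ℝ) (d : κ → ℝ)
    (e₁ e₂ e₃ : ι → ℕ) (f₁ f₂ f₃ : κ → ℕ)
    (h : ∀ x y z : ℝ, ∑ s ∈ S, c s * (x ^ e₁ s * y ^ e₂ s * z ^ e₃ s) =
      ∑ t ∈ T, d t * (x ^ f₁ t * y ^ f₂ t * z ^ f₃ t)) (p q r : ℕ) :
    (∑ s ∈ S, if e₁ s = p ∧ e₂ s = q ∧ e₃ s = r then c s else 0) =
      ∑ t ∈ T, if f₁ t = p ∧ f₂ t = q ∧ f₃ t = r then d t else 0 := by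
  classical
  let E : ℕ → ℕ → ℕ → (Fin 3 →₀ ℕ) := fun i j k => Finsupp.equivFunOnFinite.symm ![i, j, k]
  have hE : ∀ i j k i' j' k', E i j k = E i' j' k' ↔ i = i' ∧ j = j' ∧ k = k' := by
    intro i j k i' j' k'
    simp [E]
  have hev : ∀ (v : Fin 3 → ℝ) i j k (c : ℝ), MvPolynomial.eval v (MvPolynomial.monomial (E i j k) c) =
      c * (v 0 ^ i * v 1 ^ j * v 2 ^ k) := by
    intro v i j k c
    rw [MvPolynomial.eval_monomial, Finsupp.prod_fintype _ _ (by simp), Fin.prod_univ_three]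
    simp [E]
  have hP : (∑ s ∈ S, MvPolynomial.monomial (E (e₁ s) (e₂ s) (e₃ s)) (c s)) =
      ∑ t ∈ T, MvPolynomial.monomial (E (f₁ t) (f₂ t) (f₃ t)) (d t) := by
    apply MvPolynomial.funext
    intro v
    simp only [map_sum, hev]
    exact h _ _ _
  have := congrArg (MvPolynomial.coeff (E p q r)) hP
  simpa only [MvPolynomial.coeff_sum, MvPolynomial.coeff_monomial, hE] using this

/-- coefficient of `x₁^p x₂^q x₃^r` in `(x₂-x₁)^a (x₃-x₁)^b (x₃-x₂)^c`. -/
noncomputable def W (a b c p q r : ℕ) : ℝ :=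
  ∑ t ∈ Finset.range (a+1) ×ˢ Finset.range (b+1) ×ˢ Finset.range (c+1),
    if (a - t.1) + t.2.1 = p ∧ t.1 + t.2.2 = q ∧ (b - t.2.1) + (c - t.2.2) = r then
      (-1) ^ (a - t.1 + t.2.1 + t.2.2) * (a.choose t.1 : ℝ) * (b.choose t.2.1) * (c.choose t.2.2)
    else 0

theorem sum_mul3 {R ι κ μ : Type*} [CommRing R] (A : Finset ι) (B : Finset κ) (C : Finset μ)
    (f : ι → R) (g : κ → R) (h : μ → R) :
    (∑ i ∈ A, f i) * (∑ i ∈ B, g i) * (∑ i ∈ C, h i) =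
      ∑ t ∈ A ×ˢ B ×ˢ C, f t.1 * g t.2.1 * h t.2.2 := by
  simp only [Finset.sum_product, mul_assoc, ← Finset.mul_sum, ← Finset.sum_mul]

theorem expandW (a b c : ℕ) (x y z : ℝ) : (y - x) ^ a * (z - x) ^ b * (z - y) ^ c =
  ∑ t ∈ Finset.range (a+1) ×ˢ Finset.range (b+1) ×ˢ Finset.range (c+1),
      ((-1) ^ (a - t.1 + t.2.1 + t.2.2) * (a.choose t.1 : ℝ) * (b.choose t.2.1) * (c.choose t.2.2)) *
      (x ^ ((a - t.1) + t.2.1) * y ^ (t.1 + t.2.2) * z ^ ((b - t.2.1) + (c - t.2.2))) := by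
  rw [show y - x = y + (-x) by ring, show z - x = -x + z by ring, show z - y = -y + z by ring,
    add_pow, add_pow, add_pow, sum_mul3]
  refine Finset.sum_congr rfl fun i _ => ?_
  rw [neg_pow x, neg_pow x, neg_pow y]
  ring

theorem extract {R : Type*} [CommRing R] [Algebra ℝ R] (Φ : R →ₗ[ℝ] ℝ) (n₁ n₂ n₃ : ℕ)
    (Q₁ Q₂ Q₃ : ℕ → R) (K : ℝ) (a b c : ℕ)
    (h : ∀ x y z : ℝ, Φ ((∑ p ∈ Finset.range n₁, x ^ p • Q₁ p) * (∑ p ∈ Finset.range n₂, y ^ p • Q₂ p)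
      * (∑ p ∈ Finset.range n₃, z ^ p • Q₃ p)) = K * ((y - x) ^ a * (z - x) ^ b * (z - y) ^ c))
    (p q r : ℕ) (hp : p < n₁) (hq : q < n₂) (hr : r < n₃) :
    Φ (Q₁ p * Q₂ q * Q₃ r) = K * W a b c p q r := by
  have := extract_aux (Finset.range n₁ ×ˢ Finset.range n₂ ×ˢ Finset.range n₃)
    (Finset.range (a+1) ×ˢ Finset.range (b+1) ×ˢ Finset.range (c+1))
    (fun s => Φ (Q₁ s.1 * Q₂ s.2.1 * Q₃ s.2.2))
    (fun t => K * ((-1) ^ (a - t.1 + t.2.1 + t.2.2) * (a.choose t.1 : ℝ) * (b.choose t.2.1) * (c.choose t.2.2)))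
    (fun s => s.1) (fun s => s.2.1) (fun s => s.2.2)
    (fun t => (a - t.1) + t.2.1) (fun t => t.1 + t.2.2) (fun t => (b - t.2.1) + (c - t.2.2))
    (by
      intro x y z
      have h1 := h x y z
      rw [sum_mul3, map_sum, expandW, Finset.mul_sum] at h1
      simp only [mul_assoc] at h1 ⊢
      rw [← h1]
      refine Finset.sum_congr rfl fun i _ => ?_
      simp only [smul_mul_assoc, mul_smul_comm, map_smul, smul_eq_mul]
      ring) p q r
  rw [Finset.sum_eq_single (p, q, r)] at this
  · simp only [and_self, if_true] at this
    rw [this, W, Finset.mul_sum]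
    refine Finset.sum_congr rfl fun t _ => ?_
    split_ifs <;> simp
  · rintro ⟨i, j, k⟩ _ hne
    rw [if_neg]
    simpa using hne
  · intro hne
    simp [hp, hq, hr] at hne
end Gaunt

namespace Gaunt

noncomputable def Qg {R : Type*} [CommRing R] (a b c d : R) (l p : ℕ) : R :=
  ∑ t ∈ Finset.range (l+1) ×ˢ Finset.range (l+1),
    if t.1 + t.2 = p then
      ((l.choose t.1 * l.choose t.2 : ℕ) : R) * (a ^ (l - t.1) * b ^ (l - t.2) * c ^ t.1 * d ^ t.2)
    else 0

theorem Qg_sum {R : Type*} [CommRing R] (a b c d x : R) (l : ℕ) :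
    ∑ p ∈ Finset.range (2*l+1), x ^ p * Qg a b c d l p = (a + x * c) ^ l * (b + x * d) ^ l := by
  simp only [Qg, Finset.mul_sum]
  rw [Finset.sum_comm, add_comm a, add_comm b, add_pow, add_pow, Finset.sum_mul_sum, Finset.sum_product]
  refine Finset.sum_congr rfl fun i hi => Finset.sum_congr rfl fun j hj => ?_
  simp only [Finset.mem_range] at hi hj
  rw [Finset.sum_eq_single (i + j)]
  · simp only [if_true]
    push_cast
    ring
  · intro p _ hp
    rw [if_neg (Ne.symm hp), mul_zero]
  · intro h
    simp at h
    omega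

theorem map_Qg {R S : Type*} [CommRing R] [CommRing S] (f : R →+* S) (a b c d : R) (l p : ℕ) :
    f (Qg a b c d l p) = Qg (f a) (f b) (f c) (f d) l p := by
  simp only [Qg, map_sum, apply_ite f, map_mul, map_pow, map_natCast, map_zero]

noncomputable def Q (l p : ℕ) : B :=
  Qg (MvPolynomial.X 0) (MvPolynomial.X 1) (MvPolynomial.X 2) (MvPolynomial.X 3) l p

noncomputable def Phi (L : ℕ) : B →ₗ[ℝ] ℝ := MvPolynomial.lcoeff ℝ 0 ∘ₗ (Om ^ L)

theorem Phi_lin (x₁ x₂ x₃ y₁ y₂ y₃ : ℝ) (a b c l₁ l₂ l₃ : ℕ) (h₁ : a + b = 2 * l₁)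
    (h₂ : a + c = 2 * l₂) (h₃ : b + c = 2 * l₃) :
    Phi (l₁ + l₂ + l₃) (lin x₁ y₁ ^ (2*l₁) * lin x₂ y₂ ^ (2*l₂) * lin x₃ y₃ ^ (2*l₃)) =
     ((l₁ + l₂ + l₃).factorial : ℝ) * (2*l₁).factorial * (2*l₂).factorial * (2*l₃).factorial /
        (a.factorial * b.factorial * c.factorial) *
        (((x₂ - x₁) ^ a * (x₃ - x₁) ^ b * (x₃ - x₂) ^ c) *
         ((y₂ - y₁) ^ a * (y₃ - y₁) ^ b * (y₃ - y₂) ^ c)) := by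
  rw [Phi, LinearMap.comp_apply, ← h₁, ← h₂, ← h₃, Om_main _ _ _ _ _ _ _ _ _ _ (by omega)]
  simp only [MvPolynomial.lcoeff_apply, MvPolynomial.coeff_zero_C]
  simp only [mul_pow]
  ring

theorem Phi_lin_zero (x₁ x₂ x₃ y₁ y₂ y₃ : ℝ) (l₁ l₂ l₃ : ℕ)
    (h : l₁ + l₂ < l₃ ∨ l₁ + l₃ < l₂ ∨ l₂ + l₃ < l₁) :
    Phi (l₁ + l₂ + l₃) (lin x₁ y₁ ^ (2*l₁) * lin x₂ y₂ ^ (2*l₂) * lin x₃ y₃ ^ (2*l₃)) = 0 := by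
  rw [Phi, LinearMap.comp_apply, Om_zero' _ _ _ _ _ _ _ _ _ _ (by omega) (by omega), map_zero]

theorem Phi_extract (l₁ l₂ l₃ : ℕ) (K : ℝ) (a b c : ℕ)
    (h : ∀ x₁ x₂ x₃ y₁ y₂ y₃ : ℝ,
      Phi (l₁ + l₂ + l₃) (lin x₁ y₁ ^ (2*l₁) * lin x₂ y₂ ^ (2*l₂) * lin x₃ y₃ ^ (2*l₃)) =
      K * (((x₂ - x₁) ^ a * (x₃ - x₁) ^ b * (x₃ - x₂) ^ c) *
         ((y₂ - y₁) ^ a * (y₃ - y₁) ^ b * (y₃ - y₂) ^ c)))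
    (p₁ p₂ p₃ : ℕ) (h₁ : p₁ ≤ 2 * l₁) (h₂ : p₂ ≤ 2 * l₂) (h₃ : p₃ ≤ 2 * l₃) :
    ((2*l₁).choose l₁ * (2*l₂).choose l₂ * (2*l₃).choose l₃ : ℝ) *
      Phi (l₁ + l₂ + l₃) (Q l₁ p₁ * Q l₂ p₂ * Q l₃ p₃) =
    K * W a b c p₁ p₂ p₃ * W a b c l₁ l₂ l₃ := by
  set Φ := Phi (l₁ + l₂ + l₃)
  let F : ℝ → ℕ → ℕ → B := fun x n s =>
    (n.choose s : ℝ) • ((MvPolynomial.X 0 + MvPolynomial.C x * MvPolynomial.X 2) ^ (n - s) *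
        (MvPolynomial.X 1 + MvPolynomial.C x * MvPolynomial.X 3) ^ s)
  have hF : ∀ x y n, lin x y ^ n = ∑ s ∈ Finset.range (n+1), y ^ s • F x n s := by
    intro x y n
    rw [show lin x y = MvPolynomial.C y * (MvPolynomial.X 1 + MvPolynomial.C x * MvPolynomial.X 3) +
      (MvPolynomial.X 0 + MvPolynomial.C x * MvPolynomial.X 2) by rw [lin, MvPolynomial.C_mul]; ring, add_pow]
    refine Finset.sum_congr rfl fun s _ => ?_
    simp only [F, MvPolynomial.smul_eq_C_mul, MvPolynomial.C_pow, mul_pow, map_natCast]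
    ring
  have s1 : ∀ x₁ x₂ x₃ : ℝ, Φ (F x₁ (2*l₁) l₁ * F x₂ (2*l₂) l₂ * F x₃ (2*l₃) l₃) =
      K * W a b c l₁ l₂ l₃ * ((x₂ - x₁) ^ a * (x₃ - x₁) ^ b * (x₃ - x₂) ^ c) := by
    intro x₁ x₂ x₃
    rw [extract Φ (2*l₁+1) (2*l₂+1) (2*l₃+1) (F x₁ (2*l₁)) (F x₂ (2*l₂)) (F x₃ (2*l₃))
      (K * ((x₂ - x₁) ^ a * (x₃ - x₁) ^ b * (x₃ - x₂) ^ c)) a b c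
      (by intro x y z; rw [← hF, ← hF, ← hF, h]; ring) l₁ l₂ l₃ (by omega) (by omega) (by omega)]
    ring
  have hF2 : ∀ x l, F x (2*l) l = ((2*l).choose l : ℝ) • ∑ p ∈ Finset.range (2*l+1), x ^ p • Q l p := by
    intro x l
    simp only [F, MvPolynomial.smul_eq_C_mul, Q, MvPolynomial.C_pow]
    rw [Qg_sum, show 2 * l - l = l by omega]
  set D : ℝ := ((2*l₁).choose l₁ * (2*l₂).choose l₂ * (2*l₃).choose l₃ : ℝ) with hD
  have := extract (D • Φ) (2*l₁+1) (2*l₂+1) (2*l₃+1) (Q l₁) (Q l₂) (Q l₃) (K * W a b c l₁ l₂ l₃) a b c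
    (by
      intro x y z
      rw [← s1 x y z, hF2, hF2, hF2]
      simp only [smul_mul_assoc, mul_smul_comm, map_smul, smul_eq_mul, LinearMap.smul_apply, hD]
      ring) p₁ p₂ p₃ (by omega) (by omega) (by omega)
  simp only [LinearMap.smul_apply, smul_eq_mul] at this
  rw [this]; ring

end Gaunt

namespace Gaunt
theorem beta_cont (p q : ℕ) : Continuous fun θ : ℝ =>
    Real.cos (θ/2) ^ (2*p) * Real.sin (θ/2) ^ (2*q) * Real.sin θ := by fun_prop

theorem sin_half (θ : ℝ) : Real.sin θ = 2 * Real.sin (θ/2) * Real.cos (θ/2) := by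
  rw [← Real.sin_two_mul]; congr 1; ring

theorem beta_int (p : ℕ) : ∀ q : ℕ,
    ∫ θ in (0:ℝ)..Real.pi, Real.cos (θ/2) ^ (2*p) * Real.sin (θ/2) ^ (2*q) * Real.sin θ =
      2 * p.factorial * q.factorial / (p + q + 1).factorial := by
  have hs : ∀ θ : ℝ, HasDerivAt (fun θ : ℝ => Real.sin (θ/2)) (Real.cos (θ/2) * (1/2)) θ := fun θ =>
    ((hasDerivAt_id θ).div_const 2).sin
  have hc : ∀ θ : ℝ, HasDerivAt (fun θ : ℝ => Real.cos (θ/2)) (-Real.sin (θ/2) * (1/2)) θ := fun θ =>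
    ((hasDerivAt_id θ).div_const 2).cos
  induction p with
  | zero =>
    intro q
    have := intervalIntegral.integral_eq_sub_of_hasDerivAt (a := 0) (b := Real.pi)
      (f := fun θ : ℝ => 2 / (q+1) * Real.sin (θ/2) ^ (2*(q+1)))
      (f' := fun θ : ℝ => Real.cos (θ/2) ^ (2*0) * Real.sin (θ/2) ^ (2*q) * Real.sin θ)
      (fun θ _ => by
        refine (((hs θ).pow (2*(q+1))).const_mul (2 / ((q:ℝ)+1))).congr_deriv ?_
        rw [sin_half θ, show 2 * (q+1) - 1 = 2 * q + 1 by omega]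
        have : (q:ℝ) + 1 ≠ 0 := by positivity
        push_cast
        field_simp
        ring) ((beta_cont 0 q).intervalIntegrable _ _)
    rw [this]
    simp [Nat.factorial_succ]
    field_simp
  | succ p ih =>
    intro q
    have := intervalIntegral.integral_eq_sub_of_hasDerivAt (a := 0) (b := Real.pi)
      (f := fun θ : ℝ => 2 * (Real.cos (θ/2) ^ (2*(p+1)) * Real.sin (θ/2) ^ (2*(q+1))))
      (f' := fun θ : ℝ => (q+1) * (Real.cos (θ/2) ^ (2*(p+1)) * Real.sin (θ/2) ^ (2*q) * Real.sin θ)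
        - (p+1) * (Real.cos (θ/2) ^ (2*p) * Real.sin (θ/2) ^ (2*(q+1)) * Real.sin θ))
      (fun θ _ => by
        refine ((((hc θ).pow (2*(p+1))).mul ((hs θ).pow (2*(q+1)))).const_mul 2).congr_deriv ?_
        rw [sin_half θ, show 2 * (q+1) - 1 = 2 * q + 1 by omega, show 2 * (p+1) - 1 = 2 * p + 1 by omega]
        simp only [Pi.pow_apply]
        push_cast
        ring)
      ((((beta_cont (p+1) q).const_mul _).sub ((beta_cont p (q+1)).const_mul _)).intervalIntegrable _ _)
    rw [intervalIntegral.integral_sub (((beta_cont (p+1) q).const_mul _).intervalIntegrable _ _)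
      (((beta_cont p (q+1)).const_mul _).intervalIntegrable _ _),
      intervalIntegral.integral_const_mul, intervalIntegral.integral_const_mul, ih] at this
    simp at this
    have hq : (q:ℝ) + 1 ≠ 0 := by positivity
    rw [sub_eq_zero, mul_comm, ← eq_div_iff hq] at this
    rw [this, show p + 1 + q + 1 = p + (q+1) + 1 by ring]
    simp only [Nat.factorial_succ]
    push_cast
    field_simp
end Gaunt

namespace Gaunt

noncomputable def gv (θ : ℝ) : Fin 4 → ℝ :=
  ![Real.cos (θ/2), -Real.sin (θ/2), Real.sin (θ/2), Real.cos (θ/2)]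

theorem gv_cont : Continuous gv := by
  refine continuous_pi fun i => ?_
  fin_cases i <;> simp [gv] <;> fun_prop

theorem ev_cont (F : B) : Continuous fun θ => MvPolynomial.eval (gv θ) F * Real.sin θ :=
  ((MvPolynomial.continuous_eval F).comp gv_cont).mul Real.continuous_sin

noncomputable def Psi : B →ₗ[ℝ] ℝ where
  toFun F := ∫ θ in (0:ℝ)..Real.pi, MvPolynomial.eval (gv θ) F * Real.sin θ
  map_add' F G := by
    rw [← intervalIntegral.integral_add ((ev_cont F).intervalIntegrable _ _)
      ((ev_cont G).intervalIntegrable _ _)]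
    simp only [map_add, add_mul]
  map_smul' r F := by
    simp only [MvPolynomial.smul_eval, RingHom.id_apply, smul_eq_mul]
    rw [← intervalIntegral.integral_const_mul]
    simp only [mul_assoc]

theorem Phi_mono (p q : ℕ) :
    Phi (p+q) (MvPolynomial.X 0 ^ p * MvPolynomial.X 1 ^ q * MvPolynomial.X 2 ^ q * MvPolynomial.X 3 ^ p) =
     (((p+q).factorial : ℝ) * (p+q+1).factorial / 2) *
    Psi (MvPolynomial.X 0 ^ p * MvPolynomial.X 1 ^ q * MvPolynomial.X 2 ^ q * MvPolynomial.X 3 ^ p) := by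
  have h1 : Psi (MvPolynomial.X 0 ^ p * MvPolynomial.X 1 ^ q * MvPolynomial.X 2 ^ q * MvPolynomial.X 3 ^ p) =
      (-1) ^ q * (2 * p.factorial * q.factorial / (p + q + 1).factorial) := by
    rw [← beta_int, ← intervalIntegral.integral_const_mul]
    change ∫ θ in (0:ℝ)..Real.pi, _ = _
    congr 1
    ext θ
    simp [gv]
    rw [neg_pow]
    ring
  rw [h1, Phi, LinearMap.comp_apply, Om_pow_mono _ _ _ rfl]
  simp only [MvPolynomial.lcoeff_apply, MvPolynomial.coeff_zero_C]
  field_simp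

theorem Phi_Psi (l₁ l₂ l₃ p₁ p₂ p₃ : ℕ) (h : p₁ + p₂ + p₃ = l₁ + l₂ + l₃) :
    Phi (l₁ + l₂ + l₃) (Q l₁ p₁ * Q l₂ p₂ * Q l₃ p₃) =
     (((l₁ + l₂ + l₃).factorial : ℝ) * (l₁ + l₂ + l₃+1).factorial / 2) *
      Psi (Q l₁ p₁ * Q l₂ p₂ * Q l₃ p₃) := by
  simp only [Q, Qg]
  rw [sum_mul3, map_sum, map_sum, Finset.mul_sum]
  refine Finset.sum_congr rfl fun t ht => ?_
  obtain ⟨⟨i₁, j₁⟩, ⟨i₂, j₂⟩, ⟨i₃, j₃⟩⟩ := t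
  simp only [Finset.mem_product, Finset.mem_range] at ht
  dsimp only
  split_ifs with h₁ h₂ h₃
  · generalize l₁.choose i₁ * l₁.choose j₁ = c₁
    generalize l₂.choose i₂ * l₂.choose j₂ = c₂
    generalize l₃.choose i₃ * l₃.choose j₃ = c₃
    have e : ((c₁ : B) * (MvPolynomial.X 0 ^ (l₁ - i₁) * MvPolynomial.X 1 ^ (l₁ - j₁) * MvPolynomial.X 2 ^ i₁ * MvPolynomial.X 3 ^ j₁)) *
        ((c₂ : B) * (MvPolynomial.X 0 ^ (l₂ - i₂) * MvPolynomial.X 1 ^ (l₂ - j₂) * MvPolynomial.X 2 ^ i₂ * MvPolynomial.X 3 ^ j₂)) *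
        ((c₃ : B) * (MvPolynomial.X 0 ^ (l₃ - i₃) * MvPolynomial.X 1 ^ (l₃ - j₃) * MvPolynomial.X 2 ^ i₃ * MvPolynomial.X 3 ^ j₃)) =
        ((c₁ : ℝ) * c₂ * c₃) • (MvPolynomial.X 0 ^ (j₁ + j₂ + j₃) * MvPolynomial.X 1 ^ (i₁ + i₂ + i₃) *
          MvPolynomial.X 2 ^ (i₁ + i₂ + i₃) * MvPolynomial.X 3 ^ (j₁ + j₂ + j₃)) := by
      conv_rhs => rw [show j₁ + j₂ + j₃ = (l₁ - i₁) + (l₂ - i₂) + (l₃ - i₃) by omega]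
      conv_rhs => enter [2, 1, 1, 2]; rw [show i₁ + i₂ + i₃ = (l₁ - j₁) + (l₂ - j₂) + (l₃ - j₃) by omega]
      conv_rhs => enter [2, 2]; rw [show (l₁ - i₁) + (l₂ - i₂) + (l₃ - i₃) = j₁ + j₂ + j₃ by omega]
      simp only [MvPolynomial.smul_eq_C_mul, map_mul, map_natCast, pow_add]
      ring
    rw [e, map_smul, map_smul, show l₁ + l₂ + l₃ = (j₁ + j₂ + j₃) + (i₁ + i₂ + i₃) by omega, Phi_mono]
    simp only [smul_eq_mul]
    ring
  all_goals simp
end Gaunt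

namespace Gaunt

noncomputable def qf (l p : ℕ) (θ : ℝ) : ℝ := MvPolynomial.eval (gv θ) (Q l p)

theorem qf_eq (l p : ℕ) (θ : ℝ) : qf l p θ =
    Qg (Real.cos (θ/2)) (-Real.sin (θ/2)) (Real.sin (θ/2)) (Real.cos (θ/2)) l p := by
  rw [qf, Q, map_Qg]
  simp [gv]

theorem qf_symm (l p : ℕ) (hp : p ≤ 2 * l) (θ : ℝ) : qf l (2 * l - p) θ = (-1) ^ (l + p) * qf l p θ := by
  rw [qf_eq, qf_eq, Qg, Qg, Finset.mul_sum]
  refine Finset.sum_nbij' (fun t => (l - t.2, l - t.1)) (fun t => (l - t.2, l - t.1)) ?_ ?_ ?_ ?_ ?_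
  · rintro ⟨i, j⟩ h; simp at h ⊢
  · rintro ⟨i, j⟩ h; simp at h ⊢
  · rintro ⟨i, j⟩ h; simp at h ⊢; omega
  · rintro ⟨i, j⟩ h; simp at h ⊢; omega
  · rintro ⟨i, j⟩ h
    simp only [Finset.mem_product, Finset.mem_range] at h
    dsimp only
    by_cases hc : i + j = 2 * l - p
    · rw [if_pos hc, if_pos (by omega), Nat.choose_symm (by omega), Nat.choose_symm (by omega)]
      rw [show l - (l - i) = i by omega, show l - (l - j) = j by omega, neg_pow, neg_pow (Real.sin (θ/2)) i]
      have : ((-1:ℝ)) ^ (l + p) * (-1) ^ i = (-1) ^ (l - j) := by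
        rw [← pow_add, show l + p + i = (l - j) + 2 * l by omega, pow_add, pow_mul]
        simp
      rw [← this]
      push_cast
      ring_nf
    · rw [if_neg hc, if_neg (by omega), mul_zero]

theorem qf_deriv (l p : ℕ) (hp : p ≤ 2 * l) (θ : ℝ) :
    2 ^ l * Real.sin θ ^ l * qf l p θ =
      (derivative^[p] ((X ^ 2 - 1 : ℝ[X]) ^ l)).eval (Real.cos θ) / p.factorial * Real.sin θ ^ p := by
  set u := Real.cos θ with hu
  set s := Real.sin θ with hs
  have hpol : (taylor u ((X ^ 2 - 1 : ℝ[X]) ^ l)).comp (C s * X) =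
      ∑ k ∈ Finset.range (2*l+1), C (2 ^ l * s ^ l * qf l k θ) * X ^ k := by
    apply Polynomial.funext
    intro x
    have h2 := Qg_sum (Real.cos (θ/2)) (-Real.sin (θ/2)) (Real.sin (θ/2)) (Real.cos (θ/2)) x l
    simp only [← qf_eq] at h2
    rw [eval_comp, taylor_eval, eval_finset_sum]
    simp only [eval_mul, eval_C, eval_X, eval_pow, eval_sub, eval_one]
    have : ∑ k ∈ Finset.range (2*l+1), 2 ^ l * s ^ l * qf l k θ * x ^ k =
      2 ^ l * s ^ l * ∑ k ∈ Finset.range (2*l+1), x ^ k * qf l k θ := by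
      rw [Finset.mul_sum]; exact Finset.sum_congr rfl fun _ _ => by ring
    rw [this, h2, ← mul_pow, ← mul_pow, ← mul_pow]
    congr 1
    have hc : u = 2 * Real.cos (θ/2) ^ 2 - 1 := by rw [← Real.cos_two_mul, hu]; congr 1; ring
    have h1 := Real.sin_sq_add_cos_sq (θ/2)
    rw [hc, hs, sin_half θ]
    generalize Real.sin (θ/2) = S at *
    generalize Real.cos (θ/2) = c at *
    have hS : S ^ 2 = 1 - c ^ 2 := by linarith
    ring_nf
    simp only [show S ^ 3 = S * S ^ 2 by ring, hS]
    ring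
  have := congrArg (fun f => coeff f p) hpol
  simp only [comp_C_mul_X_coeff, taylor_coeff, finset_sum_coeff, coeff_C_mul_X_pow] at this
  rw [Finset.sum_ite_eq, if_pos (by simp; omega)] at this
  rw [← this]
  have h3 := congrArg (fun f => f ((X ^ 2 - 1 : ℝ[X]) ^ l)) (factorial_smul_hasseDeriv (R := ℝ) (k := p))
  simp only [LinearMap.smul_apply] at h3
  rw [← h3, eval_smul, nsmul_eq_mul, mul_div_assoc, mul_comm (p.factorial : ℝ), div_mul_cancel₀ _ (by positivity)]

noncomputable def Nf (l : ℕ) (m : ℤ) : ℝ :=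
  Real.sqrt ((2 * l + 1) / (4 * Real.pi)) *
    Real.sqrt (rfact (l + m) * rfact (l - m)) / l.factorial

theorem rfact_nat (n : ℕ) : rfact (n : ℤ) = n.factorial := by simp [rfact]

theorem rfact_neg (n : ℤ) (h : n < 0) : rfact n = 0 := by simp [rfact, h]

theorem sphNN (l n : ℕ) (hn : n ≤ l) (θ φ : ℝ) (hθ : Real.sin θ ≠ 0) :
    sphHarmNN l n θ φ = (((-1) ^ n * Nf l n * qf l (l + n) θ : ℝ) : ℂ) *
      Complex.exp ((n : ℂ) * (φ : ℂ) * Complex.I) := by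
  rw [sphHarmNN]
  congr 2
  have h := qf_deriv l (l+n) (by omega) θ
  have hq : qf l (l+n) θ = (derivative^[l+n] ((X ^ 2 - 1 : ℝ[X]) ^ l)).eval (Real.cos θ) /
      (l+n).factorial * Real.sin θ ^ n / 2 ^ l := by
    rw [pow_add] at h
    have : Real.sin θ ^ l ≠ 0 := pow_ne_zero _ hθ
    field_simp
    field_simp at h
    linear_combination h
  have hP : (derivative^[n] (legendreP l)).eval (Real.cos θ) =
      (2 ^ l * (l.factorial : ℝ))⁻¹ * (derivative^[l+n] ((X ^ 2 - 1 : ℝ[X]) ^ l)).eval (Real.cos θ) := by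
    rw [legendreP, iterate_derivative_C_mul, eval_mul, eval_C, ← Function.iterate_add_apply, add_comm n l]
  have hN : Nf l n = Real.sqrt ((2 * l + 1) / (4 * Real.pi) *
        (Nat.factorial (l - n)) / (Nat.factorial (l + n))) * (l+n).factorial / l.factorial := by
    rw [Nf, show (l:ℤ) + n = ((l + n : ℕ) : ℤ) by push_cast; rfl,
      show (l:ℤ) - n = ((l - n : ℕ) : ℤ) by rw [Nat.cast_sub hn], rfact_nat, rfact_nat]
    congr 1
    rw [← Real.sqrt_mul (by positivity)]
    have hx : ∀ x y : ℝ, 0 ≤ x → 0 ≤ y → Real.sqrt x * y = Real.sqrt (x * y ^ 2) := by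
      intro x y hx hy
      rw [Real.sqrt_mul hx, Real.sqrt_sq hy]
    rw [hx _ _ (by positivity) (by positivity)]
    congr 1
    field_simp
  rw [hP, hq, hN]
  field_simp

theorem sph (l : ℕ) (m : ℤ) (hm : m.natAbs ≤ l) (θ φ : ℝ) (hθ : Real.sin θ ≠ 0) :
    sphHarm l m θ φ = (((-1) ^ m * Nf l m * qf l (l + m).toNat θ : ℝ) : ℂ) *
      Complex.exp ((m : ℂ) * (φ : ℂ) * Complex.I) := by
  rcases le_or_gt 0 m with h | h
  · obtain ⟨n, rfl⟩ := Int.eq_ofNat_of_zero_le h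
    rw [sphHarm, if_pos h, Int.toNat_natCast, sphNN _ _ (by simpa using hm) _ _ hθ,
      show ((l:ℤ) + n).toNat = l + n by omega]
    simp
  · obtain ⟨n, rfl⟩ : ∃ n : ℕ, m = -n := ⟨m.natAbs, by omega⟩
    have hn : n ≤ l := by simpa using hm
    rw [sphHarm, if_neg (by omega), neg_neg, Int.toNat_natCast, sphNN _ _ hn _ _ hθ,
      show ((l:ℤ) + -n).toNat = 2 * l - (l + n) by omega, qf_symm l (l+n) (by omega),
      map_mul, Complex.conj_ofReal, ← Complex.exp_conj]
    have e : (starRingEnd ℂ) ((n:ℂ) * φ * Complex.I) = (((-(n:ℤ) : ℤ)) : ℂ) * φ * Complex.I := by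
      simp
    rw [e, ← mul_assoc]
    congr 1
    have hN : Nf l (-n) = Nf l n := by
      rw [Nf, Nf, sub_neg_eq_add, ← sub_eq_add_neg, mul_comm (rfact _)]
    rw [hN]
    have h1 : ((-1:ℝ)) ^ (l + (l + n)) = (-1) ^ n := by
      rw [← add_assoc, pow_add, ← two_mul, pow_mul]; simp
    rw [h1, zpow_neg, zpow_natCast]
    have h2 : ((-1:ℝ) ^ n)⁻¹ = (-1) ^ n := by rw [← inv_pow]; norm_num
    rw [h2]
    push_cast
    ring
end Gaunt

namespace Gaunt

noncomputable def Rac (l₁ l₂ l₃ m₁ m₂ : ℤ) : ℝ :=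
  ∑ k ∈ Finset.Icc (0 : ℤ) (l₁ + l₂ + l₃),
      (-1 : ℝ) ^ k /
        (rfact k * rfact (l₁ + l₂ - l₃ - k) * rfact (l₁ - m₁ - k) *
          rfact (l₂ + m₂ - k) * rfact (l₃ - l₂ + m₁ + k) * rfact (l₃ - l₁ - m₂ + k))

theorem rfact_cast (z : ℤ) (n : ℕ) (h : z = n) : rfact z = n.factorial := by
  rw [h, rfact_nat]

theorem W_racah (a b c l₁ l₂ l₃ : ℕ) (m₁ m₂ m₃ : ℤ) (h₁ : a + b = 2 * l₁)
    (h₂ : a + c = 2 * l₂) (h₃ : b + c = 2 * l₃) (hm : m₁ + m₂ + m₃ = 0)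
    (hm₁ : m₁.natAbs ≤ l₁) (hm₂ : m₂.natAbs ≤ l₂) (hm₃ : m₃.natAbs ≤ l₃) :
    W a b c (l₁ + m₁).toNat (l₂ + m₂).toNat (l₃ + m₃).toNat =
      (-1 : ℝ) ^ ((l₁ : ℤ) + l₂ - m₃) * (a.factorial * b.factorial * c.factorial) *
        Rac l₁ l₂ l₃ m₁ m₂ := by
  rw [W, Rac, ← Finset.sum_filter]
  rw [← Finset.sum_filter_of_ne (s := Finset.Icc (0 : ℤ) (l₁ + l₂ + l₃)) (p := fun k : ℤ =>
    0 ≤ (l₁:ℤ) + l₂ - l₃ - k ∧ 0 ≤ (l₁:ℤ) - m₁ - k ∧ 0 ≤ (l₂:ℤ) + m₂ - k ∧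
      0 ≤ (l₃:ℤ) - l₂ + m₁ + k ∧ 0 ≤ (l₃:ℤ) - l₁ - m₂ + k)]
  · rw [Finset.mul_sum]
    refine Finset.sum_nbij' (fun t => (t.1 : ℤ))
      (fun k => (k.toNat, ((l₃:ℤ) - l₂ + m₁ + k).toNat, ((l₂:ℤ) + m₂ - k).toNat)) ?_ ?_ ?_ ?_ ?_
    · rintro ⟨i, j, k⟩ h
      simp only [Finset.mem_filter, Finset.mem_product, Finset.mem_range, Finset.mem_Icc] at h ⊢
      omega
    · intro k h
      simp only [Finset.mem_filter, Finset.mem_product, Finset.mem_range, Finset.mem_Icc] at h ⊢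
      omega
    · rintro ⟨i, j, k⟩ h
      simp only [Finset.mem_filter, Finset.mem_product, Finset.mem_range, Prod.mk.injEq] at h ⊢
      omega
    · intro k h
      simp only [Finset.mem_filter, Finset.mem_Icc] at h
      dsimp only
      omega
    · rintro ⟨i, j, k⟩ h
      simp only [Finset.mem_filter, Finset.mem_product, Finset.mem_range] at h
      dsimp only
      rw [rfact_cast (i:ℤ) i rfl, rfact_cast (l₁ + l₂ - l₃ - i : ℤ) (a - i) (by omega),
        rfact_cast (l₁ - m₁ - i : ℤ) (b - j) (by omega),
        rfact_cast (l₂ + m₂ - i : ℤ) k (by omega),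
        rfact_cast (l₃ - l₂ + m₁ + i : ℤ) j (by omega),
        rfact_cast (l₃ - l₁ - m₂ + i : ℤ) (c - k) (by omega),
        Nat.cast_choose ℝ (show i ≤ a by omega), Nat.cast_choose ℝ (show j ≤ b by omega),
        Nat.cast_choose ℝ (show k ≤ c by omega)]
      have hs : (-1:ℝ) ^ (a - i + j + k) = (-1 : ℝ) ^ ((l₁ : ℤ) + l₂ - m₃) * (-1) ^ (i:ℤ) := by
        rw [← zpow_add₀ (by norm_num), ← zpow_natCast,
          show ((l₁:ℤ) + l₂ - m₃ + i) = ((a - i + j + k : ℕ) : ℤ) + 2 * i by omega,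
          zpow_add₀ (by norm_num), zpow_mul]
        simp
      rw [hs]
      field_simp
  · intro k hk hne
    by_contra hcon
    apply hne
    simp only [not_and_or, not_le] at hcon
    rcases hcon with h | h | h | h | h <;> rw [rfact_neg _ h] <;> simp

theorem exp_int (M : ℤ) : ∫ φ in (0:ℝ)..(2 * Real.pi), Complex.exp ((M:ℂ) * φ * Complex.I) =
    if M = 0 then 2 * Real.pi else 0 := by
  split_ifs with h
  · subst h; simp
  · have hc : (M:ℂ) * Complex.I ≠ 0 := by simp [h]
    have := integral_exp_mul_complex (a := 0) (b := 2 * Real.pi) hc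
    rw [show (fun φ : ℝ => Complex.exp ((M:ℂ) * φ * Complex.I)) =
      fun φ : ℝ => Complex.exp ((M:ℂ) * Complex.I * φ) by ext φ; congr 1; ring, this]
    have e : Complex.exp ((M:ℂ) * Complex.I * ((2 * Real.pi : ℝ) : ℂ)) = 1 := by
      rw [← Complex.exp_int_mul_two_pi_mul_I M]; congr 1; push_cast; ring
    rw [e]; simp

theorem inner_int (l₁ l₂ l₃ : ℕ) (m₁ m₂ m₃ : ℤ)
    (hm₁ : m₁.natAbs ≤ l₁) (hm₂ : m₂.natAbs ≤ l₂) (hm₃ : m₃.natAbs ≤ l₃) (θ : ℝ) :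
    (∫ φ in (0 : ℝ)..(2 * Real.pi),
        sphHarm l₁ m₁ θ φ * sphHarm l₂ m₂ θ φ * sphHarm l₃ m₃ θ φ *
          ((Real.sin θ : ℝ) : ℂ)) =
    (((if m₁ + m₂ + m₃ = 0 then 2 * Real.pi * (Nf l₁ m₁ * Nf l₂ m₂ * Nf l₃ m₃) else 0) *
      (MvPolynomial.eval (gv θ) (Q l₁ (l₁ + m₁).toNat * Q l₂ (l₂ + m₂).toNat * Q l₃ (l₃ + m₃).toNat) *
        Real.sin θ) : ℝ) : ℂ) := by
  by_cases hθ : Real.sin θ = 0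
  · simp [hθ]
  · simp only [sph _ _ hm₁ _ _ hθ, sph _ _ hm₂ _ _ hθ, sph _ _ hm₃ _ _ hθ]
    have : ∀ φ : ℝ, (((-1) ^ m₁ * Nf l₁ m₁ * qf l₁ (l₁ + m₁).toNat θ : ℝ) : ℂ) *
      Complex.exp ((m₁ : ℂ) * (φ : ℂ) * Complex.I) *
      ((((-1) ^ m₂ * Nf l₂ m₂ * qf l₂ (l₂ + m₂).toNat θ : ℝ) : ℂ) *
      Complex.exp ((m₂ : ℂ) * (φ : ℂ) * Complex.I)) *
      ((((-1) ^ m₃ * Nf l₃ m₃ * qf l₃ (l₃ + m₃).toNat θ : ℝ) : ℂ) *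
      Complex.exp ((m₃ : ℂ) * (φ : ℂ) * Complex.I)) * ((Real.sin θ : ℝ) : ℂ) =
      (((-1) ^ (m₁ + m₂ + m₃) * (Nf l₁ m₁ * Nf l₂ m₂ * Nf l₃ m₃) * (qf l₁ (l₁ + m₁).toNat θ * qf l₂ (l₂ + m₂).toNat θ *
        qf l₃ (l₃ + m₃).toNat θ * Real.sin θ) : ℝ) : ℂ) *
        Complex.exp (((m₁ + m₂ + m₃ : ℤ) : ℂ) * φ * Complex.I) := by
      intro φ
      rw [zpow_add₀ (by norm_num), zpow_add₀ (by norm_num)]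
      have : (((m₁ + m₂ + m₃ : ℤ) : ℂ) * φ * Complex.I) = (m₁ : ℂ) * (φ : ℂ) * Complex.I +
        (m₂ : ℂ) * (φ : ℂ) * Complex.I + (m₃ : ℂ) * (φ : ℂ) * Complex.I := by push_cast; ring
      rw [this, Complex.exp_add, Complex.exp_add]
      push_cast
      ring
    simp only [this]
    rw [intervalIntegral.integral_const_mul, exp_int]
    split_ifs with h
    · rw [h]
      simp only [map_mul, qf]
      push_cast
      simp
      ring
    · simp

set_option maxHeartbeats 2000000 in
theorem gaunt_aux (l₁ l₂ l₃ : ℕ) (m₁ m₂ m₃ : ℤ) (hm : m₁ + m₂ + m₃ = 0)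
    (hm₁ : m₁.natAbs ≤ l₁) (hm₂ : m₂.natAbs ≤ l₂) (hm₃ : m₃.natAbs ≤ l₃) :
    2 * Real.pi * (Nf l₁ m₁ * Nf l₂ m₂ * Nf l₃ m₃) *
      Psi (Q l₁ (l₁ + m₁).toNat * Q l₂ (l₂ + m₂).toNat * Q l₃ (l₃ + m₃).toNat) =
    Real.sqrt ((2 * l₁ + 1) * (2 * l₂ + 1) * (2 * l₃ + 1) / (4 * Real.pi)) *
          wigner3j l₁ l₂ l₃ m₁ m₂ m₃ * wigner3j l₁ l₂ l₃ 0 0 0 := by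
  have hPP := Phi_Psi l₁ l₂ l₃ (l₁ + m₁).toNat (l₂ + m₂).toNat (l₃ + m₃).toNat (by omega)
  set P := Psi (Q l₁ (l₁ + m₁).toNat * Q l₂ (l₂ + m₂).toNat * Q l₃ (l₃ + m₃).toNat) with hP
  by_cases tri : l₁ + l₂ < l₃ ∨ l₁ + l₃ < l₂ ∨ l₂ + l₃ < l₁
  · have h0 := Phi_extract l₁ l₂ l₃ 0 0 0 0 (fun x₁ x₂ x₃ y₁ y₂ y₃ => by
      rw [Phi_lin_zero _ _ _ _ _ _ _ _ _ tri]; simp) (l₁ + m₁).toNat (l₂ + m₂).toNat (l₃ + m₃).toNat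
      (by omega) (by omega) (by omega)
    rw [hPP, zero_mul, zero_mul] at h0
    have hP0 : P = 0 := by
      have c1 : ((2*l₁).choose l₁ : ℝ) ≠ 0 := by exact_mod_cast (Nat.choose_pos (by omega)).ne'
      have c2 : ((2*l₂).choose l₂ : ℝ) ≠ 0 := by exact_mod_cast (Nat.choose_pos (by omega)).ne'
      have c3 : ((2*l₃).choose l₃ : ℝ) ≠ 0 := by exact_mod_cast (Nat.choose_pos (by omega)).ne'
      have f1 : ((l₁ + l₂ + l₃).factorial : ℝ) ≠ 0 := by positivity
      have f2 : ((l₁ + l₂ + l₃ + 1).factorial : ℝ) ≠ 0 := by positivity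
      simpa [c1, c2, c3, f1, f2] using h0
    have hz : rfact ((l₁:ℤ) + l₂ - l₃) * rfact ((l₁:ℤ) - l₂ + l₃) * rfact (-(l₁:ℤ) + l₂ + l₃) = 0 := by
      rcases tri with h | h | h
      · rw [rfact_neg _ (by omega : (l₁:ℤ) + l₂ - l₃ < 0)]; simp
      · rw [rfact_neg _ (by omega : (l₁:ℤ) - l₂ + l₃ < 0)]; simp
      · rw [rfact_neg _ (by omega : -(l₁:ℤ) + l₂ + l₃ < 0)]; simp
    rw [hP0, wigner3j, if_pos hm, hz]
    simp
  · obtain ⟨a, ha⟩ : ∃ a : ℕ, a = l₁ + l₂ - l₃ := ⟨_, rfl⟩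
    obtain ⟨b, hb⟩ : ∃ b : ℕ, b = l₁ + l₃ - l₂ := ⟨_, rfl⟩
    obtain ⟨c, hc⟩ : ∃ c : ℕ, c = l₂ + l₃ - l₁ := ⟨_, rfl⟩
    have h₁ : a + b = 2 * l₁ := by omega
    have h₂ : a + c = 2 * l₂ := by omega
    have h₃ : b + c = 2 * l₃ := by omega
    have h0 := Phi_extract l₁ l₂ l₃ _ a b c
      (fun x₁ x₂ x₃ y₁ y₂ y₃ => Phi_lin x₁ x₂ x₃ y₁ y₂ y₃ a b c l₁ l₂ l₃ h₁ h₂ h₃)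
      (l₁ + m₁).toNat (l₂ + m₂).toNat (l₃ + m₃).toNat (by omega) (by omega) (by omega)
    have hW := W_racah a b c l₁ l₂ l₃ m₁ m₂ m₃ h₁ h₂ h₃ hm hm₁ hm₂ hm₃
    have hW0 := W_racah a b c l₁ l₂ l₃ 0 0 0 h₁ h₂ h₃ (by simp) (by simp) (by simp) (by simp)
    simp only [add_zero, Int.toNat_natCast, sub_zero] at hW0
    rw [hPP, hW, hW0, Nat.cast_choose ℝ (show l₁ ≤ 2 * l₁ by omega),
      Nat.cast_choose ℝ (show l₂ ≤ 2 * l₂ by omega), Nat.cast_choose ℝ (show l₃ ≤ 2 * l₃ by omega),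
      show 2 * l₁ - l₁ = l₁ by omega, show 2 * l₂ - l₂ = l₂ by omega, show 2 * l₃ - l₃ = l₃ by omega] at h0
    have hw : wigner3j l₁ l₂ l₃ m₁ m₂ m₃ = (-1 : ℝ) ^ ((l₁:ℤ) - l₂ - m₃) *
        Real.sqrt ((a.factorial * b.factorial * c.factorial : ℝ) / (l₁ + l₂ + l₃ + 1).factorial) *
        (Real.sqrt (rfact (l₁ + m₁) * rfact (l₁ - m₁)) * Real.sqrt (rfact (l₂ + m₂) * rfact (l₂ - m₂)) *
          Real.sqrt (rfact (l₃ + m₃) * rfact (l₃ - m₃))) * Rac l₁ l₂ l₃ m₁ m₂ := by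
      have nn : ∀ z, 0 ≤ rfact z := by intro z; unfold rfact; split_ifs <;> positivity
      rw [wigner3j, if_pos hm, ← Rac, rfact_cast ((l₁:ℤ) + l₂ - l₃) a (by omega),
        rfact_cast ((l₁:ℤ) - l₂ + l₃) b (by omega), rfact_cast (-(l₁:ℤ) + l₂ + l₃) c (by omega),
        rfact_cast ((l₁:ℤ) + l₂ + l₃ + 1) (l₁ + l₂ + l₃ + 1) (by push_cast; ring),
        ← Real.sqrt_mul (mul_nonneg (nn _) (nn _)),
        ← Real.sqrt_mul (mul_nonneg (mul_nonneg (nn _) (nn _)) (mul_nonneg (nn _) (nn _)))]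
      simp only [mul_assoc]
    have hw0 : wigner3j l₁ l₂ l₃ 0 0 0 = (-1 : ℝ) ^ ((l₁:ℤ) - l₂) *
        Real.sqrt ((a.factorial * b.factorial * c.factorial : ℝ) / (l₁ + l₂ + l₃ + 1).factorial) *
        (l₁.factorial * l₂.factorial * l₃.factorial) * Rac l₁ l₂ l₃ 0 0 := by
      rw [wigner3j, if_pos (by simp), ← Rac, rfact_cast ((l₁:ℤ) + l₂ - l₃) a (by omega),
        rfact_cast ((l₁:ℤ) - l₂ + l₃) b (by omega), rfact_cast (-(l₁:ℤ) + l₂ + l₃) c (by omega),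
        rfact_cast ((l₁:ℤ) + l₂ + l₃ + 1) (l₁ + l₂ + l₃ + 1) (by push_cast; ring)]
      simp only [add_zero, sub_zero, rfact_nat]
      rw [show (l₁.factorial * l₁.factorial * l₂.factorial * l₂.factorial * l₃.factorial * l₃.factorial : ℝ) =
        (l₁.factorial * l₂.factorial * l₃.factorial) ^ 2 by ring, Real.sqrt_sq (by positivity)]
    have hsq : Real.sqrt ((2 * l₁ + 1) / (4 * Real.pi)) * Real.sqrt ((2 * l₂ + 1) / (4 * Real.pi)) *
        Real.sqrt ((2 * l₃ + 1) / (4 * Real.pi)) =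
        Real.sqrt ((2 * l₁ + 1) * (2 * l₂ + 1) * (2 * l₃ + 1) / (4 * Real.pi)) / (4 * Real.pi) := by
      have hpi := Real.pi_pos
      rw [← Real.sqrt_mul (by positivity), ← Real.sqrt_mul (by positivity), eq_div_iff (by positivity)]
      conv_lhs => enter [2]; rw [← Real.sqrt_sq (show 0 ≤ 4 * Real.pi by positivity)]
      rw [← Real.sqrt_mul (by positivity)]
      congr 1
      field_simp
    have hss : (-1 : ℝ) ^ ((l₁:ℤ) - l₂ - m₃) * (-1 : ℝ) ^ ((l₁:ℤ) - l₂) =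
        (-1 : ℝ) ^ ((l₁:ℤ) + l₂ - m₃) * (-1 : ℝ) ^ ((l₁:ℤ) + l₂) := by
      rw [← zpow_add₀ (by norm_num), ← zpow_add₀ (by norm_num),
        show (l₁:ℤ) + l₂ - m₃ + (l₁ + l₂) = (l₁:ℤ) - l₂ - m₃ + (l₁ - l₂) + 2 * (2 * l₂) by ring,
        zpow_add₀ (by norm_num) _ (2 * _), zpow_mul]
      simp
    have hT : Real.sqrt ((a.factorial * b.factorial * c.factorial : ℝ) / (l₁ + l₂ + l₃ + 1).factorial) ^ 2
      = (a.factorial * b.factorial * c.factorial : ℝ) / (l₁ + l₂ + l₃ + 1).factorial :=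
      Real.sq_sqrt (by positivity)
    rw [hw, hw0]
    simp only [Nf]
    set T := Real.sqrt ((a.factorial * b.factorial * c.factorial : ℝ) / (l₁ + l₂ + l₃ + 1).factorial)
    set S := Real.sqrt ((2 * l₁ + 1) * (2 * l₂ + 1) * (2 * l₃ + 1) / (4 * Real.pi))
    generalize Real.sqrt (rfact (l₁ + m₁) * rfact (l₁ - m₁)) = u₁
    generalize Real.sqrt (rfact (l₂ + m₂) * rfact (l₂ - m₂)) = u₂
    generalize Real.sqrt (rfact (l₃ + m₃) * rfact (l₃ - m₃)) = u₃
    have hPval : P = 2 * (l₁.factorial * l₂.factorial * l₃.factorial) ^ 2 / (l₁ + l₂ + l₃ + 1).factorial *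
        (a.factorial * b.factorial * c.factorial) *
        ((-1 : ℝ) ^ ((l₁:ℤ) + l₂ - m₃) * (-1 : ℝ) ^ ((l₁:ℤ) + l₂)) * (Rac l₁ l₂ l₃ m₁ m₂ * Rac l₁ l₂ l₃ 0 0) := by
      generalize (-1 : ℝ) ^ ((l₁:ℤ) + l₂ - m₃) = s₁ at *
      generalize (-1 : ℝ) ^ ((l₁:ℤ) + l₂) = s₂ at *
      field_simp at h0 ⊢
      linear_combination h0
    rw [hPval]
    have hpi := Real.pi_ne_zero
    calc _ = 2 * Real.pi * (Real.sqrt ((2 * l₁ + 1) / (4 * Real.pi)) * Real.sqrt ((2 * l₂ + 1) / (4 * Real.pi)) *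
        Real.sqrt ((2 * l₃ + 1) / (4 * Real.pi))) * (u₁ * u₂ * u₃) *
          (2 * (l₁.factorial * l₂.factorial * l₃.factorial)) *
          ((a.factorial * b.factorial * c.factorial) / (l₁ + l₂ + l₃ + 1).factorial) *
          ((-1 : ℝ) ^ ((l₁:ℤ) + l₂ - m₃) * (-1 : ℝ) ^ ((l₁:ℤ) + l₂)) *
          (Rac l₁ l₂ l₃ m₁ m₂ * Rac l₁ l₂ l₃ 0 0) := by
            generalize (-1 : ℝ) ^ ((l₁:ℤ) + l₂ - m₃) = s₁
            generalize (-1 : ℝ) ^ ((l₁:ℤ) + l₂) = s₂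
            generalize Real.sqrt ((2 * l₁ + 1) / (4 * Real.pi)) = v₁
            generalize Real.sqrt ((2 * l₂ + 1) / (4 * Real.pi)) = v₂
            generalize Real.sqrt ((2 * l₃ + 1) / (4 * Real.pi)) = v₃
            field_simp
      _ = _ := by
        rw [hsq, ← hT, ← hss]
        generalize (-1 : ℝ) ^ ((l₁:ℤ) - l₂ - m₃) = s₁
        generalize (-1 : ℝ) ^ ((l₁:ℤ) - l₂) = s₂
        field_simp
        ring
end Gaunt

theorem gaunt_integral (l₁ l₂ l₃ : ℕ) (m₁ m₂ m₃ : ℤ)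
    (hm₁ : m₁.natAbs ≤ l₁) (hm₂ : m₂.natAbs ≤ l₂) (hm₃ : m₃.natAbs ≤ l₃) :
    (∫ θ in (0 : ℝ)..Real.pi, ∫ φ in (0 : ℝ)..(2 * Real.pi),
        sphHarm l₁ m₁ θ φ * sphHarm l₂ m₂ θ φ * sphHarm l₃ m₃ θ φ *
          ((Real.sin θ : ℝ) : ℂ)) =
      ((Real.sqrt ((2 * l₁ + 1) * (2 * l₂ + 1) * (2 * l₃ + 1) / (4 * Real.pi)) *
          wigner3j l₁ l₂ l₃ m₁ m₂ m₃ * wigner3j l₁ l₂ l₃ 0 0 0 : ℝ) : ℂ) := by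
  simp only [Gaunt.inner_int l₁ l₂ l₃ m₁ m₂ m₃ hm₁ hm₂ hm₃]
  rw [intervalIntegral.integral_ofReal, intervalIntegral.integral_const_mul]
  congr 1
  by_cases hm : m₁ + m₂ + m₃ = 0
  · rw [if_pos hm]
    exact Gaunt.gaunt_aux l₁ l₂ l₃ m₁ m₂ m₃ hm hm₁ hm₂ hm₃
  · rw [if_neg hm, wigner3j, if_neg hm]
    simp
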